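/- Each of the ten vector fields S₁ = ∂_x, S₂ = ∂_y, S₃ = x∂_y - y∂_x + ∂_α, S₄ = ℓ(sin α ∂_x - cos α ∂_y) + sin²β ∂_β, and S₅ = x∂_x + y∂_y - sin β cos β ∂_β is an infinitesimal symmetry of the split Engel structure of the car: each Sᵢ satisfies [Sᵢ, X₃] ∈ span(X₃) and [Sᵢ, X₄] ∈ span(X₄), where spans are over smooth functions. -/

import Mathlib

/- Configuration space of the car: M = ℝ⁴ with coordinates
   (x, y, α, β) = (p 0, p 1, p 2, p 3). -/
abbrev Pt : Type := Fin 4 → ℝ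
abbrev VF : Type := Pt → Pt

/-- Lie bracket of vector fields on ℝ⁴. -/
noncomputable def lieBracket (X Y : VF) : VF :=
  fun p => fderiv ℝ Y p (X p) - fderiv ℝ X p (Y p)

/-- X₃ = ∂_β -/
noncomputable def X3 : VF := fun _ => ![0, 0, 0, 1]

/-- X₄ = -sin β ∂_α + ℓ cos β (cos α ∂_x + sin α ∂_y) -/
noncomputable def X4 (ℓ : ℝ) : VF :=
  fun p => ![ℓ * Real.cos (p 3) * Real.cos (p 2),
             ℓ * Real.cos (p 3) * Real.sin (p 2),
             -Real.sin (p 3), 0]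

/-- S is an infinitesimal symmetry of the split Engel structure of the car:
    [S, X₃] = f·X₃ and [S, X₄] = g·X₄ for some smooth functions f, g. -/
def IsSplitSymmetry (ℓ : ℝ) (S : VF) : Prop :=
  (∃ f : Pt → ℝ, ContDiff ℝ (⊤ : ℕ∞) f ∧ ∀ p, lieBracket S X3 p = f p • X3 p) ∧
  (∃ g : Pt → ℝ, ContDiff ℝ (⊤ : ℕ∞) g ∧ ∀ p, lieBracket S (X4 ℓ) p = g p • X4 ℓ p)

/-- S₁ = ∂_x -/
noncomputable def S1 : VF := fun _ => ![1, 0, 0, 0]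
/-- S₂ = ∂_y -/
noncomputable def S2 : VF := fun _ => ![0, 1, 0, 0]
/-- S₃ = x∂_y - y∂_x + ∂_α -/
noncomputable def S3 : VF := fun p => ![-(p 1), p 0, 1, 0]
/-- S₄ = ℓ(sin α ∂_x - cos α ∂_y) + sin²β ∂_β -/
noncomputable def S4 (ℓ : ℝ) : VF :=
  fun p => ![ℓ * Real.sin (p 2), -(ℓ * Real.cos (p 2)), 0, (Real.sin (p 3)) ^ 2]
/-- S₅ = x∂_x + y∂_y - sin β cos β ∂_β -/
noncomputable def S5 : VF :=
  fun p => ![p 0, p 1, 0, -(Real.sin (p 3) * Real.cos (p 3))]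

lemma fderiv_X3 (p v : Pt) : fderiv ℝ X3 p v = 0 := by
  rw [show X3 = fun _ => X3 p from rfl, fderiv_fun_const]
  rfl

lemma fderiv_S1 (p v : Pt) : fderiv ℝ S1 p v = 0 := by
  rw [show S1 = fun _ => S1 p from rfl, fderiv_fun_const]
  rfl

lemma fderiv_S2 (p v : Pt) : fderiv ℝ S2 p v = 0 := by
  rw [show S2 = fun _ => S2 p from rfl, fderiv_fun_const]
  rfl

lemma fderiv_eq_of_hasFDerivAt_apply {F : VF} {p : Pt} {F' : Fin 4 → Pt →L[ℝ] ℝ}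
    (h : ∀ i, HasFDerivAt (fun q => F q i) (F' i) p) (v : Pt) :
    fderiv ℝ F p v = fun i => F' i v := by
  rw [(hasFDerivAt_pi.2 h).fderiv]
  rfl

lemma fderiv_X4 (ℓ : ℝ) (p v : Pt) : fderiv ℝ (X4 ℓ) p v =
    ![-(ℓ * Real.sin (p 3) * Real.cos (p 2)) * v 3 - ℓ * Real.cos (p 3) * Real.sin (p 2) * v 2,
      -(ℓ * Real.sin (p 3) * Real.sin (p 2)) * v 3 + ℓ * Real.cos (p 3) * Real.cos (p 2) * v 2,
      -Real.cos (p 3) * v 3, 0] := by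
  have hp := fun i : Fin 4 => hasFDerivAt_apply (𝕜 := ℝ) i p
  have h0 := ((hp 3).cos.const_mul ℓ).mul (hp 2).cos
  have h1 := ((hp 3).cos.const_mul ℓ).mul (hp 2).sin
  have h2 := (hp 3).sin.neg
  have h3 := hasFDerivAt_const (𝕜 := ℝ) (0 : ℝ) p
  rw [fderiv_eq_of_hasFDerivAt_apply (F' := ![_, _, _, _])
    (by intro i; fin_cases i; exacts [h0, h1, h2, h3])]
  ext i
  fin_cases i <;> simp <;> ring

lemma fderiv_S3 (p v : Pt) : fderiv ℝ S3 p v =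
    ![-v 1, v 0, 0, 0] := by
  have hp := fun i : Fin 4 => hasFDerivAt_apply (𝕜 := ℝ) i p
  have h0 := (hp 1).neg
  have h1 := hp 0
  have h2 := hasFDerivAt_const (𝕜 := ℝ) (1 : ℝ) p
  have h3 := hasFDerivAt_const (𝕜 := ℝ) (0 : ℝ) p
  rw [fderiv_eq_of_hasFDerivAt_apply (F' := ![_, _, _, _])
    (by intro i; fin_cases i; exacts [h0, h1, h2, h3])]
  ext i
  fin_cases i <;> simp

lemma fderiv_S4 (ℓ : ℝ) (p v : Pt) : fderiv ℝ (S4 ℓ) p v =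
    ![ℓ * Real.cos (p 2) * v 2, ℓ * Real.sin (p 2) * v 2, 0,
      2 * Real.sin (p 3) * Real.cos (p 3) * v 3] := by
  have hp := fun i : Fin 4 => hasFDerivAt_apply (𝕜 := ℝ) i p
  have h0 := (hp 2).sin.const_mul ℓ
  have h1 := ((hp 2).cos.const_mul ℓ).neg
  have h2 := hasFDerivAt_const (𝕜 := ℝ) (0 : ℝ) p
  have h3 := (hp 3).sin.pow 2
  rw [fderiv_eq_of_hasFDerivAt_apply (F' := ![_, _, _, _])
    (by intro i; fin_cases i; exacts [h0, h1, h2, h3])]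
  ext i
  fin_cases i <;> simp <;> ring

lemma fderiv_S5 (p v : Pt) : fderiv ℝ S5 p v =
    ![v 0, v 1, 0, (Real.sin (p 3) ^ 2 - Real.cos (p 3) ^ 2) * v 3] := by
  have hp := fun i : Fin 4 => hasFDerivAt_apply (𝕜 := ℝ) i p
  have h0 := hp 0
  have h1 := hp 1
  have h2 := hasFDerivAt_const (𝕜 := ℝ) (0 : ℝ) p
  have h3 := ((hp 3).sin.mul (hp 3).cos).neg
  rw [fderiv_eq_of_hasFDerivAt_apply (F' := ![_, _, _, _])
    (by intro i; fin_cases i; exacts [h0, h1, h2, h3])]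
  ext i
  fin_cases i <;> simp
  ring

/-- each of S₁, ..., S₅ is an infinitesimal symmetry of the car's split
    Engel structure. -/
theorem car_symmetries (ℓ : ℝ) (hℓ : 0 < ℓ) :
    IsSplitSymmetry ℓ S1 ∧ IsSplitSymmetry ℓ S2 ∧ IsSplitSymmetry ℓ S3 ∧
    IsSplitSymmetry ℓ (S4 ℓ) ∧ IsSplitSymmetry ℓ S5 := by
  refine ⟨⟨⟨0, contDiff_const, fun p => ?_⟩, ⟨0, contDiff_const, fun p => ?_⟩⟩,
    ⟨⟨0, contDiff_const, fun p => ?_⟩, ⟨0, contDiff_const, fun p => ?_⟩⟩,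
    ⟨⟨0, contDiff_const, fun p => ?_⟩, ⟨0, contDiff_const, fun p => ?_⟩⟩,
    ⟨⟨fun p => -(2 * Real.sin (p 3) * Real.cos (p 3)), by fun_prop, fun p => ?_⟩,
      ⟨fun p => Real.sin (p 3) * Real.cos (p 3), by fun_prop, fun p => ?_⟩⟩,
    ⟨⟨fun p => Real.cos (p 3) ^ 2 - Real.sin (p 3) ^ 2, by fun_prop, fun p => ?_⟩,
      ⟨fun p => -Real.cos (p 3) ^ 2, by fun_prop, fun p => ?_⟩⟩⟩
  all_goals
    have hβ := Real.sin_sq_add_cos_sq (p 3)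
    ext i
    simp only [lieBracket, fderiv_X3, fderiv_X4, fderiv_S1, fderiv_S2, fderiv_S3, fderiv_S4,
      fderiv_S5]
    fin_cases i <;> simp [X3, X4, S1, S2, S3, S4, S5] <;> grind
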